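/- Every regular bipartite graph of odd degree k ≥ 3 is antimagic. -/

import Mathlib

open Finset

/-- The vertex-sum of `v` under edge labeling `f`: the sum of labels on edges incident to `v`. -/
def vertexSum {V : Type*} [Fintype V] [DecidableEq V] (G : SimpleGraph V)
    [DecidableRel G.Adj] (f : Sym2 V → ℕ) (v : V) : ℕ :=
  ∑ e ∈ G.incidenceFinset v, f e

/-- A graph is antimagic if some bijective labeling of its edges by `{1, …, |E(G)|}`
has pairwise distinct vertex-sums. -/
def IsAntimagic {V : Type*} [Fintype V] [DecidableEq V] (G : SimpleGraph V)
    [DecidableRel G.Adj] : Prop :=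
  ∃ f : Sym2 V → ℕ,
    Set.BijOn f ↑G.edgeFinset ↑(Finset.Icc 1 G.edgeFinset.card) ∧
    ∀ u v : V, u ≠ v → vertexSum G f u ≠ vertexSum G f v

/-- A regular bipartite relation of positive degree contains a perfect matching. -/
theorem exists_equiv_mem_of_regular {A B : Type*} [Fintype A] [Fintype B] [DecidableEq A]
    [DecidableEq B] (k : ℕ) (hk : 0 < k) (N : A → Finset B) (hA : ∀ a, #(N a) = k)
    (hB : ∀ b, #{a | b ∈ N a} = k) : ∃ p : A ≃ B, ∀ a, p a ∈ N a := by
  have count (s : Finset A) : #s * k ≤ #(s.biUnion N) * k := by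
    calc #s * k = ∑ a ∈ s, #(N a) := by simp [hA]
      _ = ∑ a ∈ s, #((s.biUnion N).bipartiteAbove (fun a b => b ∈ N a) a) := by
        refine sum_congr rfl fun a ha => ?_
        congr 1
        ext b
        simp only [bipartiteAbove, mem_filter, mem_biUnion]
        exact ⟨fun h => ⟨⟨a, ha, h⟩, h⟩, fun h => h.2⟩
      _ = ∑ b ∈ s.biUnion N, #(s.bipartiteBelow (fun a b => b ∈ N a) b) :=
        sum_card_bipartiteAbove_eq_sum_card_bipartiteBelow _
      _ ≤ ∑ b ∈ s.biUnion N, k := by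
        refine sum_le_sum fun b _ => ?_
        rw [← hB b]
        exact card_le_card (filter_subset_filter _ (subset_univ _))
      _ = #(s.biUnion N) * k := by simp
  obtain ⟨p, hp, hpN⟩ := (all_card_le_biUnion_card_iff_exists_injective N).1
    fun s => Nat.le_of_mul_le_mul_right (count s) hk
  have hcard : Fintype.card A = Fintype.card B := by
    have := sum_card_bipartiteAbove_eq_sum_card_bipartiteBelow (s := (univ : Finset A))
      (t := (univ : Finset B)) (fun a b => b ∈ N a)
    simp only [bipartiteAbove, bipartiteBelow, hB, filter_univ_mem, hA, sum_const, card_univ,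
      smul_eq_mul] at this
    exact Nat.eq_of_mul_eq_mul_right hk this
  exact ⟨Equiv.ofBijective p ((Fintype.bijective_iff_injective_and_card p).2 ⟨hp, hcard⟩), hpN⟩

/-- A `k`-regular bipartite relation is a disjoint union of `k` perfect matchings. -/
theorem exists_equiv_decomposition {A B : Type*} [Fintype A] [Fintype B] [DecidableEq A]
    [DecidableEq B] (k : ℕ) (N : A → Finset B) (hA : ∀ a, #(N a) = k)
    (hB : ∀ b, #{a | b ∈ N a} = k) :
    ∃ p : Fin k → A ≃ B, (∀ a, Function.Injective fun j => p j a) ∧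
      ∀ a b, b ∈ N a ↔ ∃ j, p j a = b := by
  induction k generalizing N with
  | zero =>
    refine ⟨Fin.elim0, fun a i => i.elim0, fun a b => ?_⟩
    simp [card_eq_zero.1 (hA a)]
  | succ k ih =>
    obtain ⟨p, hp⟩ := exists_equiv_mem_of_regular (k + 1) k.succ_pos N hA hB
    obtain ⟨q, hq, hqN⟩ := ih (fun a => (N a).erase (p a))
      (fun a => by rw [card_erase_of_mem (hp a), hA, Nat.add_sub_cancel]) (fun b => by
        have : ({a | b ∈ (N a).erase (p a)} : Finset A)
            = ({a | b ∈ N a} : Finset A).erase (p.symm b) := by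
          ext a
          simp [Equiv.eq_symm_apply, eq_comm]
        rw [this, card_erase_of_mem (by simpa using hp (p.symm b)), hB, Nat.add_sub_cancel])
    have hne (a : A) (j : Fin k) : q j a ≠ p a :=
      (mem_erase.1 ((hqN a _).2 ⟨j, rfl⟩)).1
    refine ⟨Fin.cons p q, fun a i j => ?_, fun a b => ?_⟩
    · refine Fin.cases ?_ (fun i => ?_) i <;> refine Fin.cases ?_ (fun j => ?_) j
      · simp
      · intro h; exact absurd h.symm (hne a j)
      · intro h; exact absurd h (hne a i)
      · intro h; exact congrArg Fin.succ (hq a h)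
    · rw [Fin.exists_fin_succ]
      have := hqN a b
      simp only [mem_erase] at this
      simp only [Fin.cons_zero, Fin.cons_succ, ← this]
      by_cases h : p a = b
      · subst h; simp [hp]
      · simp [h, Ne.symm h]

/-- The elements of a finite type can be ranked compatibly with any key function. -/
theorem exists_equiv_fin_strictMono {B K : Type*} [Fintype B] [LinearOrder K] (κ : B → K) :
    ∃ r : B ≃ Fin (Fintype.card B), ∀ x y, κ x < κ y → r x < r y := by
  let e := Fintype.equivFin B
  let σ := Tuple.sort (κ ∘ e.symm)
  have hσ : Monotone ((κ ∘ e.symm) ∘ σ) := Tuple.monotone_sort _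
  refine ⟨e.trans σ.symm, fun x y hxy => ?_⟩
  by_contra! h
  have := hσ h
  simp at this
  exact absurd hxy this.not_gt

theorem rank_lt_card {B : Type*} [Fintype B] [DecidableEq B] {n : ℕ} (r : B ≃ Fin n) (X : Finset B)
    (h : ∀ x ∈ X, ∀ y ∉ X, r x < r y) {x : B} (hx : x ∈ X) : (r x : ℕ) < #X := by
  have hsub : (Iic (r x)).map r.symm.toEmbedding ⊆ X := by
    intro y hy
    by_contra hyX
    have := h x hx y hyX
    simp only [mem_map, mem_Iic, Equiv.coe_toEmbedding] at hy
    obtain ⟨i, hi, rfl⟩ := hy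
    simp at this
    exact absurd hi this.not_ge
  have := card_le_card hsub
  rw [card_map, Fin.card_Iic] at this
  omega

theorem le_rank_add_card {B : Type*} [Fintype B] [DecidableEq B] {n : ℕ} (r : B ≃ Fin n)
    (Y : Finset B) (h : ∀ x ∉ Y, ∀ y ∈ Y, r x < r y) {y : B} (hy : y ∈ Y) :
    n ≤ (r y : ℕ) + #Y := by
  have := rank_lt_card (r.trans Fin.revPerm) Y
    (fun x hx y hy => by simpa using h y hy x hx) hy
  simp at this
  omega

/-- If `R` meets every forward orbit of `π`, some 2-coloring alternates along `π` outside `R`. -/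
theorem exists_alternating {B : Type*} (π : Equiv.Perm B) (R : Set B)
    (hR : ∀ b, ∃ d : ℕ, (π ^ d) b ∈ R) : ∃ ε : B → Bool, ∀ b ∉ R, ε b ≠ ε (π b) := by
  classical
  refine ⟨fun b => decide (Even (Nat.find (hR b))), fun b hb => ?_⟩
  have h : Nat.find (hR b) = Nat.find (hR (π b)) + 1 := by
    apply Nat.find_comp_succ
    simpa using hb
  by_cases he : Even (Nat.find (hR (π b))) <;> simp [h, Nat.even_add_one, he]

/-- For two fixed-point-free permutations, some set meets every cycle of the first while its
complement meets every cycle of the second. -/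
theorem exists_disjoint_transversals {B : Type*} [Fintype B] (σ τ : Equiv.Perm B)
    (hσ : ∀ b, σ b ≠ b) (hτ : ∀ b, τ b ≠ b) :
    ∃ R : Set B, (∀ b, ∃ d : ℕ, (σ ^ d) b ∈ R) ∧ ∀ b, ∃ d : ℕ, (τ ^ d) b ∉ R := by
  classical
  let f : B → Quotient (Equiv.Perm.SameCycle.setoid σ) := fun b => ⟦b⟧
  let g : B → Quotient (Equiv.Perm.SameCycle.setoid τ) := fun b => ⟦b⟧
  let r : Quotient (Equiv.Perm.SameCycle.setoid σ) ⊕ Quotient (Equiv.Perm.SameCycle.setoid τ) →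
    B → Prop := fun i b => i = .inl (f b) ∨ i = .inr (g b)
  let t i : Finset B := {b | r i b}
  have ht i : 2 ≤ #(t i) := by
    rw [← Nat.lt_iff_add_one_le, one_lt_card]
    rcases i with i | i <;> induction i using Quotient.inductionOn with | _ b
    · refine ⟨σ b, ?_, b, ?_, hσ b⟩
      · simp only [t, r, mem_filter_univ]
        exact Or.inl (congrArg _ (Quotient.sound (Equiv.Perm.sameCycle_apply_right.2 (.refl _ _))))
      · simp [t, r, f]
    · refine ⟨τ b, ?_, b, ?_, hτ b⟩
      · simp only [t, r, mem_filter_univ]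
        exact Or.inr (congrArg _ (Quotient.sound (Equiv.Perm.sameCycle_apply_right.2 (.refl _ _))))
      · simp [t, r, g]
  have hall (s) : #s ≤ #(s.biUnion t) := by
    refine Nat.le_of_mul_le_mul_right (?_ : #s * 2 ≤ #(s.biUnion t) * 2) two_pos
    calc #s * 2 = ∑ i ∈ s, 2 := by simp
      _ ≤ ∑ i ∈ s, #((s.biUnion t).bipartiteAbove r i) := by
        refine sum_le_sum fun i hi => (ht i).trans (card_le_card fun b hb => ?_)
        exact mem_filter.2 ⟨mem_biUnion.2 ⟨i, hi, hb⟩, (mem_filter.1 hb).2⟩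
      _ = ∑ b ∈ s.biUnion t, #(s.bipartiteBelow r b) :=
        sum_card_bipartiteAbove_eq_sum_card_bipartiteBelow _
      _ ≤ ∑ b ∈ s.biUnion t, 2 := by
        refine sum_le_sum fun b _ =>
          (card_le_card (t := {Sum.inl (f b), Sum.inr (g b)}) ?_).trans card_le_two
        intro i hi
        simpa [r] using (mem_filter.1 hi).2
      _ = #(s.biUnion t) * 2 := by simp
  obtain ⟨φ, hφ, hφt⟩ := (all_card_le_biUnion_card_iff_exists_injective t).1 hall
  refine ⟨Set.range fun q => φ (.inl q), fun b => ?_, fun b => ?_⟩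
  · have h := hφt (.inl (f b))
    simp only [t, r, mem_filter_univ, Sum.inl.injEq, reduceCtorEq, or_false] at h
    have h' : σ.SameCycle b (φ (.inl (f b))) := Quotient.exact h
    obtain ⟨d, -, hd⟩ := h'.exists_pow_eq'
    exact ⟨d, f b, hd.symm⟩
  · have h := hφt (.inr (g b))
    simp only [t, r, mem_filter_univ, Sum.inr.injEq, reduceCtorEq, false_or] at h
    have h' : τ.SameCycle b (φ (.inr (g b))) := Quotient.exact h
    obtain ⟨d, -, hd⟩ := h'.exists_pow_eq'
    refine ⟨d, ?_⟩
    rintro ⟨q, hq⟩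
    rw [hd] at hq
    exact absurd (hφ hq) (by simp)

/-- A fixed-point-free permutation has a 2-coloring failing to alternate at no two consecutive
elements and at no more than a third of all elements. -/
theorem exists_almost_alternating {A : Type*} [Fintype A] [DecidableEq A] (π : Equiv.Perm A)
    (hπ : ∀ a, π a ≠ a) : ∃ ε : A → Bool, (∀ a, ε a = ε (π a) → ε (π a) ≠ ε (π (π a))) ∧
      3 * #{a | ε a = ε (π a)} ≤ Fintype.card A := by
  obtain ⟨ε, -, hmin⟩ := exists_min_image (univ : Finset (A → Bool))
    (fun ε => #{a | ε a = ε (π a)}) univ_nonempty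
  replace hmin (δ : A → Bool) (h : ∀ a, δ a = δ (π a) → ε a = ε (π a)) (a : A)
      (ha : ε a = ε (π a)) : δ a = δ (π a) := by
    have hsub : ({a | δ a = δ (π a)} : Finset A) ⊆ ({a | ε a = ε (π a)} : Finset A) := by
      intro x; simpa using h x
    have := eq_of_subset_of_card_le hsub (hmin δ (mem_univ _))
    have h2 : a ∈ ({a | δ a = δ (π a)} : Finset A) := by rw [this]; simpa using ha
    simpa using h2
  have hone (a : A) (ha : ε a = ε (π a)) : ε (π a) ≠ ε (π (π a)) := by
    intro h
    have := hmin (fun x => if x = π a then !ε x else ε x) (fun x => by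
      by_cases h1 : x = a
      · intro; rwa [h1]
      by_cases h2 : x = π a
      · intro; rwa [h2]
      simp [h1, h2]) a ha
    simp [ha, (hπ a).symm] at this
  have htwo (a : A) (ha : ε a = ε (π a)) : ε (π (π a)) ≠ ε (π (π (π a))) := by
    intro h
    have hne : a ≠ π (π a) := fun h' => hone a ha (by rw [← h', ha])
    have := hmin (fun x => if x = π a ∨ x = π (π a) then !ε x else ε x) (fun x => by
      by_cases h1 : x = a
      · intro; rwa [h1]
      by_cases h2 : x = π (π a)
      · intro; rwa [h2]
      by_cases h3 : x = π a <;> simp [h1, h2, h3]) a ha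
    simp [ha, (hπ a).symm, hne] at this
  refine ⟨ε, hone, ?_⟩
  set E : Finset A := {a | ε a = ε (π a)} with hE
  have h1 : Disjoint E (E.map π.toEmbedding) := by
    rw [disjoint_left]
    simp only [mem_map, Equiv.coe_toEmbedding, hE, mem_filter_univ]
    rintro _ h ⟨a, ha, rfl⟩
    exact hone a ha h
  have h2 : Disjoint (E ∪ E.map π.toEmbedding) ((E.map π.toEmbedding).map π.toEmbedding) := by
    rw [disjoint_left]
    simp only [mem_union, mem_map, Equiv.coe_toEmbedding, hE, mem_filter_univ]
    rintro _ h ⟨_, ⟨a, ha, rfl⟩, rfl⟩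
    rcases h with h | ⟨b, hb, hba⟩
    · exact htwo a ha h
    · rw [π.injective hba] at hb
      exact hone a ha hb
  have := card_le_univ (E ∪ E.map π.toEmbedding ∪ (E.map π.toEmbedding).map π.toEmbedding)
  rw [card_union_of_disjoint h2, card_union_of_disjoint h1] at this
  simp only [card_map] at this
  omega

theorem exists_rank_sums_ne {B : Type*} [Fintype B] [DecidableEq B] (k c : ℤ) (hk : 0 < k)
    (hc : k ∣ c) (Q : B → ℤ) (hQ : ∀ b, k ∣ Q b → Q b + k * #{b | k ∣ Q b} ≤ c) :
    ∃ r : B ≃ Fin (Fintype.card B), (Function.Injective fun b => Q b + k * ((r b : ℕ) + 1)) ∧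
      ∀ b (t : ℕ), Q b + k * ((r b : ℕ) + 1) ≠ c + k * (t + 1) := by
  obtain ⟨r, hr⟩ := exists_equiv_fin_strictMono
    fun b => (toLex (!decide (k ∣ Q b), Q b) : Bool ×ₗ ℤ)
  have key (b b') (h : (k ∣ Q b ↔ k ∣ Q b')) (hlt : Q b < Q b') :
      Q b + k * ((r b : ℕ) + 1) < Q b' + k * ((r b' : ℕ) + 1) := by
    have h1 : r b < r b' := hr _ _ (Prod.Lex.toLex_lt_toLex.2 (Or.inr ⟨by simp [h], hlt⟩))
    have h2 : ((r b : ℕ) : ℤ) < (r b' : ℕ) := by exact_mod_cast h1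
    nlinarith
  have hdvd (b : B) (s : ℤ) : k ∣ Q b + k * s ↔ k ∣ Q b :=
    (Int.dvd_add_left (Dvd.intro s rfl))
  refine ⟨r, fun b b' h => ?_, fun b t h => ?_⟩
  · simp only at h
    have hiff : k ∣ Q b ↔ k ∣ Q b' := by rw [← hdvd b, h, hdvd]
    rcases lt_trichotomy (Q b) (Q b') with hlt | heq | hlt
    · exact absurd h (key _ _ hiff hlt).ne
    · rw [heq, add_right_inj] at h
      have := mul_left_cancel₀ hk.ne' h
      exact r.injective (Fin.ext (by omega))
    · exact absurd h (key _ _ hiff.symm hlt).ne'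
  · have hb : k ∣ Q b := by
      rw [← hdvd b, h]
      exact dvd_add hc (Dvd.intro _ rfl)
    have hlt := rank_lt_card r ({b | k ∣ Q b} : Finset B) (fun x hx y hy => hr _ _
      (Prod.Lex.toLex_lt_toLex.2 (Or.inl (by simp_all)))) (mem_filter_univ _ |>.2 hb)
    have hle : ((r b : ℕ) : ℤ) + 1 ≤ (#{b | k ∣ Q b} : ℕ) := by exact_mod_cast hlt
    have := hQ b hb
    nlinarith

/-- The two labels `i + kj` and `kn - i - kj`, which add up to `kn`; the second is congruent
to `-i` modulo `k`. -/
def pairLabel (k n i : ℤ) (β : Bool) (j : ℤ) : ℤ :=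
  if β then i + k * j else k * n - i - k * j

theorem pairLabel_add_not (k n i : ℤ) (β : Bool) (j : ℤ) :
    pairLabel k n i β j + pairLabel k n i (!β) j = k * n := by
  cases β <;> simp [pairLabel]

theorem pairLabel_mem_Icc {k n i j : ℤ} (hi : 0 < i) (hik : i < k) (hj : 0 ≤ j) (hjn : j < n)
    (β : Bool) : pairLabel k n i β j ∈ Set.Icc 1 (k * n) := by
  have h1 : 0 ≤ k * j := mul_nonneg (by omega) hj
  have h2 : k * (j + 1) ≤ k * n := by gcongr <;> omega
  rw [mul_add] at h2
  cases β <;> simp [pairLabel] <;> omega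

theorem not_dvd_pairLabel {k n i j : ℤ} (hi : 0 < i) (hik : i < k) (β : Bool) :
    ¬ k ∣ pairLabel k n i β j := by
  intro h
  have : k ∣ i := by
    cases β
    · have h' := dvd_sub (Dvd.intro (n - j) rfl : k ∣ k * (n - j)) h
      rwa [show k * (n - j) - pairLabel k n i false j = i by simp [pairLabel]; ring] at h'
    · simpa [pairLabel] using h
  exact absurd (Int.le_of_dvd hi this) (by omega)

theorem pairLabel_inj {k n i j i' j' : ℤ} {β β' : Bool} (hi : 0 < i) (hi' : 0 < i')
    (hik : 2 * i < k) (hik' : 2 * i' < k) (h : pairLabel k n i β j = pairLabel k n i' β' j') :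
    i = i' ∧ β = β' ∧ j = j' := by
  have small (x y : ℤ) (hx : |x| < k) (hxy : x = k * y) : x = 0 ∧ y = 0 := by
    have h0 := Int.eq_zero_of_abs_lt_dvd ⟨y, hxy⟩ hx
    refine ⟨h0, ?_⟩
    rw [h0] at hxy
    rcases mul_eq_zero.1 hxy.symm with h | h <;> omega
  cases β <;> cases β' <;> simp only [pairLabel, if_true, Bool.false_eq_true, if_false] at h
  · have := small (i - i') (j' - j) (by rw [abs_lt]; omega) (by linarith)
    refine ⟨by omega, rfl, by omega⟩
  · have := small (i + i') (n - j - j') (by rw [abs_lt]; omega) (by linarith)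
    omega
  · have := small (i + i') (n - j - j') (by rw [abs_lt]; omega) (by linarith)
    omega
  · have := small (i - i') (j' - j) (by rw [abs_lt]; omega) (by linarith)
    refine ⟨by omega, rfl, by omega⟩

/-- The sum of the labels at a vertex incident to edges in two paired matchings whose other ends
are `x` and `y`. -/
def pairSum {A : Type*} (k n i : ℤ) (ε : A → Bool) (j : A → ℕ) (x y : A) : ℤ :=
  pairLabel k n i (ε x) (j x) + pairLabel k n i (!ε y) (j y)

theorem dvd_pairSum_sub {A : Type*} (k n i : ℤ) (ε : A → Bool) (j : A → ℕ) (x y : A) :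
    k ∣ pairSum k n i ε j x y - (if ε x = ε y then 0 else if ε x then 2 * i else -(2 * i)) := by
  unfold pairSum pairLabel
  rcases hx : ε x <;> rcases hy : ε y <;> simp
  · exact ⟨n - j x + j y, by ring⟩
  · exact ⟨n - j x + (n - j y), by ring⟩
  · exact ⟨(j x + j y), by ring⟩
  · exact ⟨n + j x - j y, by ring⟩

theorem exists_pairSum_of_one_pair {A B : Type*} [Fintype A] [Fintype B] [DecidableEq A]
    [DecidableEq B] (e e' : B ≃ A) (he : ∀ b, e b ≠ e' b) :
    ∃ (ε : A → Bool) (j : A ≃ Fin (Fintype.card A)), ∀ b,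
      3 ∣ pairSum 3 (Fintype.card A) 1 ε (fun a => j a) (e b) (e' b) →
      pairSum 3 (Fintype.card A) 1 ε (fun a => j a) (e b) (e' b)
        + 3 * #{b | 3 ∣ pairSum 3 (Fintype.card A) 1 ε (fun a => j a) (e b) (e' b)}
        ≤ 3 * Fintype.card A := by
  obtain ⟨ε, hε, hcard⟩ := exists_almost_alternating (e.symm.trans e')
    fun a h => he (e.symm a) (by simpa using h.symm)
  set π := e.symm.trans e' with hπ
  have hπe (b : B) : π (e b) = e' b := by simp [hπ]
  set E : Finset A := {a | ε a = ε (π a)} with hE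
  have hmemE a : a ∈ E ↔ ε a = ε (π a) := by simp [hE]
  let X := E.image fun a => if ε a then a else π a
  let Y := E.image fun a => if ε a then π a else a
  have hXY : Disjoint X Y := by
    rw [disjoint_left]
    simp only [X, Y, mem_image, hmemE]
    rintro _ ⟨a, ha, rfl⟩ ⟨a', ha', h⟩
    split_ifs at h with h1 h2 h2
    · subst h; exact hε _ ha' ha
    · rw [π.injective h] at h1; exact h2 h1
    · rw [h] at h1; exact h1 h2
    · subst h; exact hε _ ha ha'
  obtain ⟨j, hj⟩ := exists_equiv_fin_strictMono
    fun a => if a ∈ X then 0 else if a ∈ Y then 2 else 1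
  have hjX {a} (ha : a ∈ X) : (j a : ℕ) < #E :=
    (rank_lt_card j X (fun x hx y hy => hj _ _ (by
      simp only [hx, hy, if_true, if_false]; split_ifs <;> norm_num)) ha).trans_le
      card_image_le
  have hjY {a} (ha : a ∈ Y) : Fintype.card A ≤ (j a : ℕ) + #E :=
    (le_rank_add_card j Y (fun x hx y hy => hj _ _ (by
      simp only [hx, hy, disjoint_right.1 hXY hy, if_true, if_false]; split_ifs <;> norm_num)) ha).trans
      (Nat.add_le_add_left card_image_le _)
  have hiff b : 3 ∣ pairSum 3 (Fintype.card A) 1 ε (fun a => j a) (e b) (e' b) ↔ e b ∈ E := by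
    have := dvd_pairSum_sub 3 (Fintype.card A) 1 ε (fun a => j a) (e b) (e' b)
    rw [hmemE, hπe]
    by_cases h : ε (e b) = ε (e' b)
    · simpa [h] using this
    · rw [if_neg h] at this
      simp only [h, iff_false]
      split_ifs at this <;> omega
  have hcount : #{b | 3 ∣ pairSum 3 (Fintype.card A) 1 ε (fun a => j a) (e b) (e' b)} = #E := by
    simp only [hiff]
    rw [← card_map e.toEmbedding]
    congr 1
    ext a
    simp
  refine ⟨ε, j, fun b hb => ?_⟩
  rw [hcount]
  have hbE := (hiff b).1 hb
  have hεb := (hmemE _).1 hbE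
  have hX : (if ε (e b) then e b else π (e b)) ∈ X := mem_image_of_mem _ hbE
  have hY : (if ε (e b) then π (e b) else e b) ∈ Y := mem_image_of_mem _ hbE
  rw [hπe] at hX hY hεb
  unfold pairSum pairLabel
  rw [← hεb]
  cases h : ε (e b) <;> simp only [h, if_true, Bool.false_eq_true, if_false, Bool.not_false,
    Bool.not_true] at hX hY ⊢
  all_goals
    have h1 := hjX hX
    have h2 := hjY hY
    omega

theorem exists_pairSum_not_dvd {A B : Type*} [Fintype A] [Fintype B] (m : ℕ)
    (e : Fin (m + 2) → Bool → (B ≃ A)) (he : ∀ i b, e i true b ≠ e i false b) (n : ℤ)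
    (j : Fin (m + 2) → A → ℕ) :
    ∃ ε : Fin (m + 2) → A → Bool, ∀ b,
      ¬ (2 * (m + 2 : ℕ) + 1 : ℤ) ∣ ∑ i : Fin (m + 2), pairSum (2 * (m + 2 : ℕ) + 1) n ((i : ℕ) + 1) (ε i) (j i)
        (e i true b) (e i false b) := by
  let π (i) : Equiv.Perm B := (e i false).trans (e i true).symm
  have hπ i b : π i b ≠ b := fun h => he i b ((Equiv.symm_apply_eq _).1 h).symm
  have hπe i b : e i true (π i b) = e i false b := by simp [π]
  obtain ⟨R, h0, h1⟩ := exists_disjoint_transversals (π 0) (π 1) (hπ 0) (hπ 1)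
  obtain ⟨ε₀, hε₀⟩ := exists_alternating _ R h0
  obtain ⟨ε₁, hε₁⟩ := exists_alternating _ Rᶜ h1
  refine ⟨Fin.cons (ε₀ ∘ (e 0 true).symm) (Fin.cons (ε₁ ∘ (e 1 true).symm) fun _ _ => true),
    fun b => ?_⟩
  rw [Fin.sum_univ_succ, Fin.sum_univ_succ]
  set k : ℤ := 2 * (m + 2 : ℕ) + 1 with hk
  have hk5 : 5 ≤ k := by push_cast at hk; omega
  rw [← add_assoc, Int.dvd_add_left]
  swap
  · refine dvd_sum fun i _ => ?_
    simpa using dvd_pairSum_sub k n (((i.succ.succ : Fin (m + 2)) : ℕ) + 1) (fun _ => true)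
      (j i.succ.succ) (e i.succ.succ true b) (e i.succ.succ false b)
  have d0 := dvd_pairSum_sub k n 1 (ε₀ ∘ (e 0 true).symm) (j 0) (e 0 true b) (e 0 false b)
  have d1 := dvd_pairSum_sub k n 2 (ε₁ ∘ (e 1 true).symm) (j 1) (e 1 true b) (e 1 false b)
  have hR : ε₀ b ≠ ε₀ (π 0 b) ∨ ε₁ b ≠ ε₁ (π 1 b) := by
    by_cases hb : b ∈ R
    · exact Or.inr (hε₁ b (by simpa using hb))
    · exact Or.inl (hε₀ b hb)
  have e0 : (e 0 true).symm (e 0 false b) = π 0 b := rfl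
  have e1 : (e 1 true).symm (e 1 false b) = π 1 b := rfl
  have small (y : ℤ) (hy0 : y ≠ 0) (hy : |y| < k) : ¬ k ∣ 2 * y := fun h2 =>
    hy0 (Int.eq_zero_of_abs_lt_dvd (IsCoprime.dvd_of_dvd_mul_left
      ⟨1, -(m + 2 : ℕ), by rw [hk]; ring⟩ h2) hy)
  intro h
  have h' := dvd_sub h (dvd_add d0 d1)
  simp only [Fin.cons_zero, Fin.cons_succ, Fin.val_zero, Fin.val_succ, Nat.cast_zero,
    Nat.cast_one, zero_add, one_add_one_eq_two] at h'
  simp only [Fin.succ_zero_eq_one, add_sub_add_comm, sub_sub_cancel, Function.comp_apply,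
    Equiv.symm_apply_apply, e0, e1] at h'
  refine small ((if ε₀ b = ε₀ (π 0 b) then 0 else if ε₀ b then 1 else -1)
    + (if ε₁ b = ε₁ (π 1 b) then 0 else if ε₁ b then 2 else -2)) ?_ ?_ ?_
  · rcases hR with hR | hR <;> rw [if_neg hR] <;> split_ifs <;> norm_num
  · rw [abs_lt]; split_ifs <;> omega
  · rw [mul_add, mul_ite, mul_ite, mul_ite, mul_ite]
    simpa using h'

theorem exists_pairSum {A B : Type*} [Fintype A] [Fintype B] [DecidableEq A] [DecidableEq B]
    (m : ℕ) (hm : 0 < m) (e : Fin m → Bool → (B ≃ A))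
    (he : ∀ i b, e i true b ≠ e i false b) :
    ∃ (ε : Fin m → A → Bool) (j : Fin m → A ≃ Fin (Fintype.card A)) (Q : B → ℤ),
      (∀ b, Q b = ∑ i : Fin m, pairSum (2 * m + 1) (Fintype.card A) ((i : ℕ) + 1) (ε i)
        (fun a => j i a) (e i true b) (e i false b)) ∧
      ∀ b, (2 * m + 1 : ℤ) ∣ Q b → Q b + (2 * m + 1) * #{b | (2 * m + 1 : ℤ) ∣ Q b}
        ≤ (2 * m + 1) * Fintype.card A * m := by
  obtain rfl | ⟨m, rfl⟩ : m = 1 ∨ ∃ m', m = m' + 2 := by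
    rcases m with _ | _ | m
    · omega
    · exact Or.inl rfl
    · exact Or.inr ⟨m, rfl⟩
  · obtain ⟨ε, j, h⟩ := exists_pairSum_of_one_pair (e 0 true) (e 0 false) (he 0)
    exact ⟨fun _ => ε, fun _ => j, _, fun _ => rfl, by simpa using h⟩
  · obtain ⟨ε, h⟩ := exists_pairSum_not_dvd m e he (Fintype.card A)
      fun _ a => Fintype.equivFin A a
    exact ⟨ε, fun _ => Fintype.equivFin A, _, fun _ => rfl, fun b hb => absurd hb (h b)⟩

/-- A decomposition of a `(2 * m + 1)`-regular bipartite graph into perfect matchings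
`e x : B ≃ A` admits an antimagic labeling: `g a x` is the label of the edge at `a` in the
matching `x`. -/
theorem exists_antimagic_label {A B : Type*} [Fintype A] [Fintype B] [DecidableEq A]
    [DecidableEq B] (m : ℕ) (hm : 0 < m) (e : Option (Fin m × Bool) → (B ≃ A))
    (he : ∀ b, Function.Injective fun x => e x b) :
    ∃ g : A → Option (Fin m × Bool) → ℤ,
      (∀ a x a' x', g a x = g a' x' → a = a' ∧ x = x') ∧
      (∀ a x, g a x ∈ Set.Icc 1 ((2 * m + 1) * Fintype.card A : ℤ)) ∧
      (Function.Injective fun a => ∑ x, g a x) ∧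
      (Function.Injective fun b => ∑ x, g (e x b) x) ∧
      ∀ a b, ∑ x, g a x ≠ ∑ x, g (e x b) x := by
  obtain ⟨ε, j, Q, hQ, hQk⟩ := exists_pairSum m hm (fun i β => e (some (i, β)))
    fun i b h => by simpa using he b h
  set k : ℤ := 2 * m + 1 with hk
  set n : ℤ := ((Fintype.card A : ℕ) : ℤ)
  obtain ⟨r, hr, hrc⟩ := exists_rank_sums_ne k (k * n * m) (by omega)
    ⟨n * m, by ring⟩ Q hQk
  have hcard : Fintype.card B = Fintype.card A := Fintype.card_congr (e none)
  let s (a : A) : ℕ := r ((e none).symm a)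
  have hs a : s a < Fintype.card A := hcard ▸ (r _).isLt
  let g (a : A) (x : Option (Fin m × Bool)) : ℤ := x.elim (k * (s a + 1))
    fun x => pairLabel k n ((x.1 : ℕ) + 1) (ε x.1 a == x.2) (j x.1 a : ℕ)
  have hgA a : ∑ x, g a x = k * n * m + k * (s a + 1) := by
    simp [g, Fintype.sum_option, Fintype.sum_prod_type, pairLabel_add_not]
    ring
  have hgB b : ∑ x, g (e x b) x = Q b + k * ((r b : ℕ) + 1) := by
    simp [g, s, Fintype.sum_option, Fintype.sum_prod_type, hQ, pairSum, add_comm]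
  have hdvd (a : A) (i : Fin m) (β : Bool) (t : ℤ) :
      k * t ≠ pairLabel k n ((i : ℕ) + 1) β (j i a : ℕ) := fun h =>
    not_dvd_pairLabel (by omega) (by omega) β ⟨t, h.symm⟩
  refine ⟨g, fun a x a' x' h => ?_, fun a x => ?_, fun a a' h => ?_, fun b b' h => ?_,
    fun a b h => ?_⟩
  · rcases x with _ | ⟨i, β⟩ <;> rcases x' with _ | ⟨i', β'⟩ <;>
      simp only [g, Option.elim_none, Option.elim_some] at h
    · have := mul_left_cancel₀ (by omega) h
      have h2 : r ((e none).symm a) = r ((e none).symm a') := Fin.ext (by simp only [s] at this; omega)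
      simpa using h2
    · exact absurd h (hdvd _ _ _ _)
    · exact absurd h.symm (hdvd _ _ _ _)
    · obtain ⟨h1, h2, h3⟩ := pairLabel_inj (by omega) (by omega) (by omega) (by omega) h
      obtain rfl : i = i' := Fin.ext (by omega)
      obtain rfl : a = a' := (j i).injective (Fin.ext (by omega))
      refine ⟨rfl, ?_⟩
      revert h2
      cases ε i a <;> cases β <;> cases β' <;> simp
  · rcases x with _ | ⟨i, β⟩
    · have := hs a
      simp only [g, Option.elim_none, Set.mem_Icc]
      constructor <;> nlinarith
    · exact pairLabel_mem_Icc (by omega) (by omega) (by omega) (by omega) _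
  · simp only [hgA, add_right_inj] at h
    have := mul_left_cancel₀ (by omega) h
    have h2 : r ((e none).symm a) = r ((e none).symm a') := Fin.ext (by simp only [s] at this; omega)
    simpa using h2
  · simp only [hgB] at h
    exact hr h
  · rw [hgA, hgB] at h
    exact hrc b _ h.symm

theorem isAntimagic_of_equiv_family {V A B ι : Type*} [Fintype V] [DecidableEq V] [Fintype A]
    [Fintype B] [Fintype ι] [DecidableEq ι] (G : SimpleGraph V)
    [DecidableRel G.Adj] (φ : A ⊕ B ≃ V) (e : ι → (B ≃ A))
    (he : ∀ b, Function.Injective fun x => e x b)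
    (hadj : ∀ u v, G.Adj u v ↔ ∃ b x, s(φ (.inl (e x b)), φ (.inr b)) = s(u, v))
    (g : A → ι → ℕ) (hg : ∀ a x a' x', g a x = g a' x' → a = a' ∧ x = x')
    (hgm : ∀ a x, g a x ∈ Finset.Icc 1 (Fintype.card ι * Fintype.card A))
    (hA : Function.Injective fun a => ∑ x, g a x)
    (hB : Function.Injective fun b => ∑ x, g (e x b) x)
    (hAB : ∀ a b, ∑ x, g a x ≠ ∑ x, g (e x b) x) : IsAntimagic G := by
  classical
  let F (p : A × ι) : Sym2 V := s(φ (.inl p.1), φ (.inr ((e p.2).symm p.1)))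
  have hFB b x : F (e x b, x) = s(φ (.inl (e x b)), φ (.inr b)) := by simp [F]
  have hF : Function.Injective F := by
    rintro ⟨a, x⟩ ⟨a', x'⟩ h
    simp only [F, Sym2.eq_iff, φ.injective.eq_iff, Sum.inl.injEq, Sum.inr.injEq, reduceCtorEq,
      false_and, or_false] at h
    obtain ⟨rfl, h⟩ := h
    have : x = x' := he ((e x).symm a) (by simp only [Equiv.apply_symm_apply]; rw [h]; simp)
    rw [this]
  have hadjF d : d ∈ G.edgeSet ↔ ∃ p, F p = d := by
    induction d with | _ u v
    rw [SimpleGraph.mem_edgeSet, hadj]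
    constructor
    · rintro ⟨b, x, h⟩
      exact ⟨(e x b, x), by rw [hFB, h]⟩
    · rintro ⟨⟨a, x⟩, h⟩
      exact ⟨(e x).symm a, x, by simpa [F] using h⟩
  have hedge : G.edgeFinset = univ.image F := by
    ext d
    simp [hadjF]
  have hcard : G.edgeFinset.card = Fintype.card ι * Fintype.card A := by
    rw [hedge, card_image_of_injective _ hF, card_univ, Fintype.card_prod, mul_comm]
  let f : Sym2 V → ℕ := Function.extend F (fun p => g p.1 p.2) 0
  have hf p : f (F p) = g p.1 p.2 := hF.extend_apply _ _ _
  have hincA a : G.incidenceFinset (φ (.inl a)) = univ.image fun x => F (a, x) := by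
    ext d
    simp only [SimpleGraph.mem_incidenceFinset, SimpleGraph.incidenceSet, hadjF, mem_image,
      mem_univ, true_and]
    constructor
    · rintro ⟨⟨⟨a', x⟩, rfl⟩, h⟩
      simp [F] at h
      exact ⟨x, by rw [h]⟩
    · rintro ⟨x, rfl⟩
      exact ⟨⟨_, rfl⟩, by simp [F]⟩
  have hincB b : G.incidenceFinset (φ (.inr b)) = univ.image fun x => F (e x b, x) := by
    ext d
    simp only [SimpleGraph.mem_incidenceFinset, SimpleGraph.incidenceSet, hadjF, mem_image,
      mem_univ, true_and]
    constructor
    · rintro ⟨⟨⟨a', x⟩, rfl⟩, h⟩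
      simp [F] at h
      exact ⟨x, by rw [h]; simp⟩
    · rintro ⟨x, rfl⟩
      exact ⟨⟨_, rfl⟩, by simp [F]⟩
  have hsumA a : vertexSum G f (φ (.inl a)) = ∑ x, g a x := by
    rw [vertexSum, hincA, sum_image fun x _ y _ h => (Prod.ext_iff.1 (hF h)).2]
    simp only [hf]
  have hsumB b : vertexSum G f (φ (.inr b)) = ∑ x, g (e x b) x := by
    rw [vertexSum, hincB, sum_image fun x _ y _ h => (Prod.ext_iff.1 (hF h)).2]
    simp only [hf]
  have hmaps : Set.MapsTo f G.edgeFinset (Finset.Icc 1 G.edgeFinset.card) := by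
    intro d hd
    obtain ⟨p, rfl⟩ := (hadjF d).1 (by simpa using hd)
    rw [hf, hcard]
    exact hgm _ _
  have hinj : Set.InjOn f G.edgeFinset := by
    intro d hd d' hd' h
    obtain ⟨p, rfl⟩ := (hadjF d).1 (by simpa using hd)
    obtain ⟨p', rfl⟩ := (hadjF d').1 (by simpa using hd')
    rw [hf, hf] at h
    rw [Prod.ext_iff.2 (hg _ _ _ _ h)]
  refine ⟨f, ⟨hmaps, hinj, surjOn_of_injOn_of_card_le f hmaps hinj (by simp)⟩, fun u v huv => ?_⟩
  obtain ⟨u, rfl⟩ := φ.surjective u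
  obtain ⟨v, rfl⟩ := φ.surjective v
  rcases u with a | b <;> rcases v with a' | b' <;> simp only [hsumA, hsumB]
  · exact fun h => huv (by rw [hA h])
  · exact hAB a b'
  · exact (hAB a' b).symm
  · exact fun h => huv (by rw [hB h])

theorem stmt_13 {V : Type*} [Fintype V] [DecidableEq V] (G : SimpleGraph V)
    [DecidableRel G.Adj] (k : ℕ) (hk : 3 ≤ k) (hodd : Odd k)
    (c : V → Bool) (hbip : ∀ u v, G.Adj u v → c u ≠ c v)
    (hreg : G.IsRegularOfDegree k) : IsAntimagic G := by
  obtain ⟨m, rfl⟩ := hodd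
  let A := {v // c v = true}
  let B := {v // ¬ c v = true}
  have degree_eq {p : V → Prop} [DecidablePred p] (v : V) (h : ∀ w, G.Adj v w → p w) :
      #{w : Subtype p | G.Adj v w} = 2 * m + 1 := by
    rw [← hreg v, ← G.card_neighborFinset_eq_degree, ← card_map (.subtype p)]
    congr 1
    ext w
    simpa using h w
  obtain ⟨q, hq, hqN⟩ := exists_equiv_decomposition (2 * m + 1)
    (fun b : B => ({a : A | G.Adj b a} : Finset A))
    (fun b => degree_eq b.1 fun w hw => by
      have := hbip _ _ hw; have := b.2; revert this; grind)
    (fun a => by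
      simpa [G.adj_comm] using degree_eq (p := fun v => ¬ c v = true) a.1 fun w hw => by
        have := hbip _ _ hw; have := a.2; grind)
  simp only [mem_filter_univ] at hqN
  let ψ : Option (Fin m × Bool) ≃ Fin (2 * m + 1) :=
    Fintype.equivFinOfCardEq (by simp [mul_comm])
  have he (b : B) : Function.Injective fun x => q (ψ x) b := (hq b).comp ψ.injective
  obtain ⟨g, hg, hgm, hA, hB, hAB⟩ := exists_antimagic_label m (by omega) (fun x => q (ψ x)) he
  have hcast a x : ((g a x).toNat : ℤ) = g a x :=
    Int.toNat_of_nonneg (by have := (hgm a x).1; omega)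
  refine isAntimagic_of_equiv_family G (Equiv.sumCompl fun v => c v = true) (fun x => q (ψ x)) he
    (fun u v => ?_) (fun a x => (g a x).toNat) (fun a x a' x' h => hg _ _ _ _ ?_) (fun a x => ?_)
    (fun a a' h => hA ?_) (fun b b' h => hB ?_) (fun a b h => hAB a b ?_)
  · constructor
    · intro h
      have key (a : A) (b : B) (hab : G.Adj b a) : ∃ x, q (ψ x) b = a := by
        obtain ⟨j, hj⟩ := (hqN b a).1 hab
        exact ⟨ψ.symm j, by simpa using hj⟩
      have hne := hbip _ _ h
      by_cases hu : c u = true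
      · obtain ⟨x, hx⟩ := key ⟨u, hu⟩ ⟨v, by grind⟩ h.symm
        exact ⟨⟨v, by grind⟩, x, by rw [hx]; simp⟩
      · obtain ⟨x, hx⟩ := key ⟨v, by grind⟩ ⟨u, hu⟩ h
        exact ⟨⟨u, hu⟩, x, by rw [hx]; simp⟩
    · rintro ⟨b, x, h⟩
      have hab := (hqN b (q (ψ x) b)).2 ⟨_, rfl⟩
      rw [← SimpleGraph.mem_edgeSet, ← h]
      simpa using hab.symm
  · rw [← hcast, h, hcast]
  · obtain ⟨h1, h2⟩ := hgm a x
    rw [← hcast] at h1 h2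
    simp only [Finset.mem_Icc, Fintype.card_option, Fintype.card_prod, Fintype.card_fin,
      Fintype.card_bool, mul_comm m 2]
    exact ⟨by exact_mod_cast h1, by exact_mod_cast h2⟩
  all_goals
    have := congrArg (Nat.cast : ℕ → ℤ) h
    simpa [hcast] using this
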